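/- Let Σ and Δ be disjoint alphabets, let n ≥ 1, let x = x_1 x_2 ⋯ x_n be a word over Σ and w = w_1 w_2 ⋯ w_n a word over Δ with |x| = |w| = n. If w is squarefree, then the perfect shuffle x_1 w_1 x_2 w_2 ⋯ x_n w_n is squarefree. -/

import Mathlib

/-- A word is squarefree if it has no factor of the form `u u` with `u` nonempty. -/
def SqfWord {α : Type*} (w : List α) : Prop :=
  ¬ ∃ s t u : List α, u ≠ [] ∧ w = s ++ u ++ u ++ t

/-- Keeping the letters of the second alphabet in a perfect shuffle recovers the second word. -/
lemma filterMap_getRight?_shuffle {σ₁ σ₂ : Type*} (x : List σ₁) (w : List σ₂)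
    (h : x.length = w.length) :
    ((List.zipWith (fun a b => [Sum.inl a, Sum.inr b]) x w).flatten :
      List (σ₁ ⊕ σ₂)).filterMap Sum.getRight? = w := by
  induction x generalizing w with
  | nil => cases w <;> simp_all
  | cons a x ih =>
    cases w with
    | nil => simp at h
    | cons b w => simpa [-List.filterMap_flatten, List.filterMap_cons] using ih w (by simpa using h)

/-- In a perfect shuffle no two consecutive letters come from the first alphabet. -/
lemma isChain_shuffle {σ₁ σ₂ : Type*} (x : List σ₁) (w : List σ₂) :
    ((List.zipWith (fun a b => [Sum.inl a, Sum.inr b]) x w).flatten :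
      List (σ₁ ⊕ σ₂)).IsChain (fun a b => a.isLeft → b.isRight) := by
  induction x generalizing w with
  | nil => simp
  | cons a x ih =>
    cases w with
    | nil => simp
    | cons b w =>
      simpa [List.isChain_cons] using ih w

/-- If `x` and `w` are words of the same length `n ≥ 1` over disjoint alphabets and
`w` is squarefree, then the perfect shuffle `x₁w₁x₂w₂⋯xₙwₙ` is squarefree. -/
theorem perfect_shuffle_squarefree {σ₁ σ₂ : Type*} (n : ℕ) (hn : 1 ≤ n)
    (x : List σ₁) (w : List σ₂) (hx : x.length = n) (hw : w.length = n)
    (hsf : SqfWord w) :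
    SqfWord ((List.zipWith (fun a b => [Sum.inl a, Sum.inr b]) x w).flatten :
      List (σ₁ ⊕ σ₂)) := by
  rintro ⟨s, t, u, hu, h⟩
  have hproj := filterMap_getRight?_shuffle x w (hx.trans hw.symm)
  have hchain := isChain_shuffle x w
  rw [h] at hproj hchain
  refine hsf ⟨s.filterMap Sum.getRight?, t.filterMap Sum.getRight?,
    u.filterMap Sum.getRight?, fun hnil => ?_, by simpa using hproj.symm⟩
  have hleft : ∀ a ∈ u, a.isLeft := by
    simpa [List.filterMap_eq_nil_iff] using hnil
  have huu : (u ++ u).IsChain (fun a b => a.isLeft → b.isRight) :=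
    hchain.infix ⟨s, t, by simp⟩
  clear hproj hchain h hnil
  rcases u with _ | ⟨a, _ | ⟨b, v⟩⟩
  · exact hu rfl
  · cases a <;> simp_all
  · cases a <;> cases b <;> simp_all
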